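/- Let E ⊆ ℝ² be closed and simply connected with induced path metric d̄, let T be a simple geodesic triangle in (E,d̄) with exterior U, and let L be a straight line through a non-vertex point p on edge A of T. Suppose r > 0 satisfies T ∩ B(p,r) ⊂ A, and let L⁻, L⁺ be the two components of (L ∩ B(p,r)) \ {p}. Then at least one of L⁻, L⁺ is disjoint from U; moreover, if L⁻ meets T (within B(p,r)) then L⁺ is disjoint from U. -/

import Mathlib

open Set

noncomputable def pathLength {X : Type*} [PseudoEMetricSpace X] {x y : X} (c : Path x y) : ENNReal :=
  eVariationOn (fun t : unitInterval => c t) Set.univ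

noncomputable def pathEDist {X : Type*} [PseudoEMetricSpace X] (x y : X) : ENNReal :=
  ⨅ c : Path x y, pathLength c

/-- A unit-speed geodesic segment of the path metric `pathEDist`, parametrized on
`[0, D]`, from `x` to `y`. -/
def IsGeodesicSegment {X : Type*} [MetricSpace X] (γ : ℝ → X) (D : ℝ) (x y : X) : Prop :=
  γ 0 = x ∧ γ D = y ∧
    ∀ s ∈ Set.Icc 0 D, ∀ t ∈ Set.Icc 0 D, pathEDist (γ s) (γ t) = ENNReal.ofReal |s - t|

/-- A simple closed curve: the image of a topological circle under a continuous
injective map. -/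
def IsSimpleClosedCurve {M : Type*} [TopologicalSpace M] (s : Set M) : Prop :=
  ∃ φ : Metric.sphere (0 : EuclideanSpace ℝ (Fin 2)) 1 → M,
    Continuous φ ∧ Function.Injective φ ∧ Set.range φ = s

/-- A simple geodesic triangle in `(E, d̄)`: three vertices `p`, `q`, `r` of `E`, joined
pairwise by geodesic segments of the induced path metric on `E`, whose union is a
simple closed curve in the ambient space `M`. -/
structure SimpleGeodesicTriangle {M : Type*} [MetricSpace M] (E : Set M) where
  p : E
  q : E
  r : E
  σ : ℝ → E
  τ : ℝ → E
  ρ : ℝ → E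
  a : ℝ
  b : ℝ
  c : ℝ
  ha : 0 ≤ a
  hb : 0 ≤ b
  hc : 0 ≤ c
  hσ : IsGeodesicSegment σ a p q
  hτ : IsGeodesicSegment τ b p r
  hρ : IsGeodesicSegment ρ c q r
  simple : IsSimpleClosedCurve
    ((Subtype.val ∘ σ) '' Set.Icc 0 a ∪ (Subtype.val ∘ τ) '' Set.Icc 0 b ∪
      (Subtype.val ∘ ρ) '' Set.Icc 0 c)

namespace SimpleGeodesicTriangle

variable {M : Type*} [MetricSpace M] {E : Set M} (T : SimpleGeodesicTriangle E)

/-- The image of the triangle in the ambient space. -/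
def im : Set M :=
  (Subtype.val ∘ T.σ) '' Set.Icc 0 T.a ∪ (Subtype.val ∘ T.τ) '' Set.Icc 0 T.b ∪
    (Subtype.val ∘ T.ρ) '' Set.Icc 0 T.c

def edgePQ : Set M := (Subtype.val ∘ T.σ) '' Set.Icc 0 T.a
def edgePR : Set M := (Subtype.val ∘ T.τ) '' Set.Icc 0 T.b
def edgeQR : Set M := (Subtype.val ∘ T.ρ) '' Set.Icc 0 T.c

/-- `A` is an edge of the triangle `T`. -/
def IsEdge (A : Set M) : Prop := A = T.edgePQ ∨ A = T.edgePR ∨ A = T.edgeQR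

/-- The (Jordan) interior of the simple closed curve `T`: the points of the bounded
complementary component. -/
def interior : Set M :=
  {w | w ∉ T.im ∧ Bornology.IsBounded (connectedComponentIn T.imᶜ w)}

/-- The (Jordan) exterior of the simple closed curve `T`: the points of the unbounded
complementary component. -/
def exterior : Set M :=
  {w | w ∉ T.im ∧ ¬ Bornology.IsBounded (connectedComponentIn T.imᶜ w)}

end SimpleGeodesicTriangle

/-- `z ↦ z - w` admits a continuous logarithm on `K`. -/
def HasContinuousLog (K : Set ℂ) (w : ℂ) : Prop :=
  ∃ g : ℂ → ℂ, ContinuousOn g K ∧ ∀ z ∈ K, Complex.exp (g z) = z - w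

theorem exists_continuous_log {X : Type*} [TopologicalSpace X] [SimplyConnectedSpace X]
    [LocallyPathConnectedSpace X] {f : X → ℂ} (hf : Continuous f) (h0 : ∀ x, f x ≠ 0) :
    ∃ g : X → ℂ, Continuous g ∧ ∀ x, Complex.exp (g x) = f x := by
  obtain ⟨x₀⟩ : Nonempty X := inferInstance
  obtain ⟨F, ⟨-, hF⟩, -⟩ := Complex.isCoveringMapOn_exp.existsUnique_continuousMap_lifts
    ⟨f, hf⟩ (a₀ := x₀) (Complex.exp_log (h0 x₀)) h0
  exact ⟨F, F.continuous, fun x => congrFun hF x⟩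

/-- Two continuous logarithms of the same function on a preconnected set differ by a constant. -/
theorem IsPreconnected.sub_eq_sub_of_exp_eq {X : Type*} [TopologicalSpace X] {s : Set X}
    (hs : IsPreconnected s) {f g : X → ℂ} (hf : ContinuousOn f s) (hg : ContinuousOn g s)
    (h : ∀ x ∈ s, Complex.exp (f x) = Complex.exp (g x)) {x y : X} (hx : x ∈ s) (hy : y ∈ s) :
    f y - f x = g y - g x := by
  have key := Complex.isCoveringMap_exp.eqOn_of_comp_eqOn (A := X) hs hf
    (g₂ := fun z => g z + (f x - g x)) (hg.add continuousOn_const)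
    (fun z hz => by
      apply Subtype.ext
      simp only [Function.comp_apply, Complex.exp_add, Complex.exp_sub, h x hx, h z hz]
      rw [div_self (Complex.exp_ne_zero _), mul_one]) hx (by ring)
  have := key hy
  simp only at this
  rw [this]; ring

theorem HasContinuousLog.of_norm_lt {K : Set ℂ} {w w' : ℂ} (hw : HasContinuousLog K w)
    (h : ∀ z ∈ K, ‖w - w'‖ < ‖z - w‖) : HasContinuousLog K w' := by
  obtain ⟨g, hg, hgz⟩ := hw
  have hne : ∀ z ∈ K, z - w ≠ 0 := fun z hz h0 => by
    have := h z hz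
    rw [h0, norm_zero] at this
    exact absurd this (not_lt.2 (norm_nonneg _))
  have hs : ∀ z ∈ K, 1 + (w - w') / (z - w) ∈ Complex.slitPlane := fun z hz => by
    apply Complex.mem_slitPlane_of_norm_lt_one
    rw [norm_div, div_lt_one (norm_pos_iff.2 (hne z hz))]
    exact h z hz
  refine ⟨fun z => g z + Complex.log (1 + (w - w') / (z - w)), hg.add ?_, fun z hz => ?_⟩
  · refine ContinuousOn.clog (continuousOn_const.add (continuousOn_const.div ?_ hne)) hs
    fun_prop
  · rw [Complex.exp_add, hgz z hz, Complex.exp_log (Complex.slitPlane_ne_zero (hs z hz))]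
    field_simp [hne z hz]
    ring

theorem HasContinuousLog.of_not_isBounded {K : Set ℂ} (hK : IsCompact K) {w : ℂ}
    (hb : ¬ Bornology.IsBounded (connectedComponentIn Kᶜ w)) : HasContinuousLog K w := by
  obtain ⟨R, hR⟩ := hK.isBounded.subset_closedBall 0
  have hwK : w ∈ Kᶜ := by
    by_contra hw
    rw [connectedComponentIn_eq_empty hw] at hb
    exact hb Bornology.isBounded_empty
  obtain ⟨w₁, hw₁, hw₁R⟩ : ∃ w₁ ∈ connectedComponentIn Kᶜ w, R < ‖w₁‖ := by
    by_contra! hcon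
    exact hb ((Metric.isBounded_closedBall (x := (0 : ℂ)) (r := R)).subset
      fun x hx => by simpa using hcon x hx)
  have hlog : HasContinuousLog K w₁ := by
    have hw0 : w₁ ≠ 0 ∨ K = ∅ := by
      by_contra! hcon
      obtain ⟨h0, z, hz⟩ := hcon
      have := hR hz
      simp only [Metric.mem_closedBall, dist_zero_right] at this
      rw [h0, norm_zero] at hw₁R
      linarith [norm_nonneg z]
    rcases hw0 with hw0 | rfl
    · have hs : ∀ z ∈ K, 1 + -(z / w₁) ∈ Complex.slitPlane := fun z hz => by
        apply Complex.mem_slitPlane_of_norm_lt_one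
        rw [norm_neg, norm_div, div_lt_one (norm_pos_iff.2 hw0)]
        have := hR hz
        simp only [Metric.mem_closedBall, dist_zero_right] at this
        linarith
      refine ⟨fun z => Complex.log (-w₁) + Complex.log (1 + -(z / w₁)),
        continuousOn_const.add (ContinuousOn.clog (by fun_prop) hs), fun z hz => ?_⟩
      rw [Complex.exp_add, Complex.exp_log (neg_ne_zero.2 hw0),
        Complex.exp_log (Complex.slitPlane_ne_zero (hs z hz))]
      field_simp
      ring
    · exact ⟨fun _ => 0, continuousOn_const, fun z hz => hz.elim⟩
  refine (isPreconnected_connectedComponentIn.induction₂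
    (fun x y => HasContinuousLog K x ↔ HasContinuousLog K y) ?_ (fun x y z _ _ _ => Iff.trans)
    (fun x y _ _ => Iff.symm) hw₁ (mem_connectedComponentIn hwK)).1 hlog
  intro x hx
  have hxK : x ∈ Kᶜ := connectedComponentIn_subset _ _ hx
  obtain ⟨ε, hε, hball⟩ := Metric.isOpen_iff.1 hK.isClosed.isOpen_compl x hxK
  refine mem_nhdsWithin_of_mem_nhds (Filter.mem_of_superset
    (Metric.ball_mem_nhds x (half_pos hε)) fun y hy => ?_)
  have hy' : ‖x - y‖ < ε / 2 := by rwa [← dist_eq_norm, dist_comm]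
  have hz : ∀ z ∈ K, ε ≤ ‖z - x‖ := fun z hz => by
    by_contra! hcon
    exact hball (by rwa [Metric.mem_ball, dist_eq_norm]) hz
  refine ⟨fun h => h.of_norm_lt fun z hzK => ?_, fun h => h.of_norm_lt fun z hzK => ?_⟩
  · linarith [hz z hzK]
  · have := norm_sub_le_norm_sub_add_norm_sub z y x
    rw [norm_sub_rev y x] at *
    linarith [hz z hzK]

theorem frontier_connectedComponentIn_subset {X : Type*} [TopologicalSpace X]
    [LocallyConnectedSpace X] {U : Set X} (hU : IsOpen U) (w : X) :
    frontier (connectedComponentIn U w) ⊆ Uᶜ := by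
  intro x hx hxU
  have hopen : IsOpen (connectedComponentIn U w) := hU.connectedComponentIn
  rw [hopen.frontier_eq] at hx
  obtain ⟨y, hy₁, hy₂⟩ := mem_closure_iff.1 hx.1 _ (hU.connectedComponentIn (x := x))
    (mem_connectedComponentIn hxU)
  apply hx.2
  rw [connectedComponentIn_eq hy₂, ← connectedComponentIn_eq hy₁]
  exact mem_connectedComponentIn hxU

/-- A point of a bounded complementary component of `K` admits no logarithm on `K`. -/
theorem not_hasContinuousLog_of_isBounded {K : Set ℂ} (hK : IsClosed K) {w : ℂ} (hw : w ∉ K)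
    (hb : Bornology.IsBounded (connectedComponentIn Kᶜ w)) : ¬ HasContinuousLog K w := by
  classical
  rintro ⟨g, hg, hgz⟩
  set V := connectedComponentIn Kᶜ w with hV
  obtain ⟨G, hG⟩ := ContinuousMap.exists_restrict_eq hK
    (⟨K.domRestrict g, continuousOn_iff_continuous_domRestrict.1 hg⟩ : C(K, ℂ))
  have hGg : ∀ z ∈ K, G z = g z := fun z hz => congrFun (congrArg DFunLike.coe hG) ⟨z, hz⟩
  have hF : Continuous fun z => if z ∈ V then Complex.exp (G z) else z - w := by
    refine Continuous.if (fun z hz => ?_) (by fun_prop) (by fun_prop)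
    have hzK : z ∈ K := by
      simpa using frontier_connectedComponentIn_subset hK.isOpen_compl w hz
    rw [hGg z hzK, hgz z hzK]
  have hwV : w ∈ V := mem_connectedComponentIn hw
  obtain ⟨L, hL, hLz⟩ := exists_continuous_log hF fun z => by
    split_ifs with h
    · exact Complex.exp_ne_zero _
    · exact sub_ne_zero.2 fun h' => h (h' ▸ hwV)
  obtain ⟨R, hR0, hR⟩ := hb.subset_ball_lt 0 w
  have hcirc : ∀ θ : ℝ, Complex.exp (L (w + R * Complex.exp (θ * Complex.I))) =
      Complex.exp (Real.log R + θ * Complex.I) := fun θ => by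
    rw [hLz, if_neg, Complex.exp_add, ← Complex.ofReal_exp, Real.exp_log hR0]
    · ring
    · intro h
      have := hR h
      simp [Complex.norm_exp_ofReal_mul_I, abs_of_pos hR0] at this
  have := (isPreconnected_univ (α := ℝ)).sub_eq_sub_of_exp_eq
    (f := fun θ : ℝ => L (w + R * Complex.exp (θ * Complex.I)))
    (g := fun θ : ℝ => Real.log R + θ * Complex.I)
    (by fun_prop) (by fun_prop) (fun θ _ => hcirc θ) (Set.mem_univ 0) (Set.mem_univ (2 * Real.pi))
  simp [Complex.exp_two_pi_mul_I] at this

theorem exists_log_loop {X : Type*} [TopologicalSpace X] [SimplyConnectedSpace X] {f : X → ℂ}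
    (hf : Continuous f) (h0 : ∀ x, f x ≠ 0) {x : X} (c : Path x x) :
    ∃ l : unitInterval → ℂ, Continuous l ∧ (∀ t, Complex.exp (l t) = f (c t)) ∧ l 0 = l 1 := by
  obtain ⟨H⟩ := SimplyConnectedSpace.paths_homotopic c (Path.refl x)
  obtain ⟨L, hL, hLz⟩ := exists_continuous_log (f := fun a : ℝ × ℝ =>
      f (H (Set.projIcc 0 1 zero_le_one a.1, Set.projIcc 0 1 zero_le_one a.2)))
    (by fun_prop) fun _ => h0 _
  have hHL : ∀ s t : unitInterval, Complex.exp (L (s, t)) = f (H (s, t)) := fun s t => by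
    rw [hLz]
    simp
  refine ⟨fun t => L (0, t), by fun_prop, fun t => ?_, ?_⟩
  · simpa using hHL 0 t
  · have key : ∀ p : unitInterval → unitInterval × unitInterval, Continuous p →
        (∀ t, H (p t) = x) → L ((p 1).1, (p 1).2) = L ((p 0).1, (p 0).2) := fun p hp hx => by
      have := (isPreconnected_univ (α := unitInterval)).sub_eq_sub_of_exp_eq
        (f := fun t => L ((p t).1, (p t).2))
        (g := fun _ => L ((p 0).1, (p 0).2)) (by fun_prop) (by fun_prop)
        (fun t _ => by simp only [hHL, Prod.mk.eta, hx]) (Set.mem_univ 0) (Set.mem_univ 1)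
      simpa [sub_eq_zero] using this
    have e₁ := key (fun t => (t, 0)) (by fun_prop) (by simp)
    have e₂ := key (fun t => (1, t)) (by fun_prop) (by simp)
    have e₃ := key (fun t => (t, 1)) (by fun_prop) (by simp)
    simp only [Set.Icc.coe_zero, Set.Icc.coe_one] at e₁ e₂ e₃ ⊢
    rw [← e₁, ← e₃, e₂]

theorem exists_log_circle {X : Type*} [TopologicalSpace X] [SimplyConnectedSpace X] {f : X → ℂ}
    (hf : Continuous f) (h0 : ∀ x, f x ≠ 0) {c : Circle → X} (hc : Continuous c) :
    ∃ l : Circle → ℂ, Continuous l ∧ ∀ z, Complex.exp (l z) = f (c z) := by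
  let e : unitInterval → Circle := fun t => Circle.exp (2 * Real.pi * t)
  have he : Continuous e := by fun_prop
  have he0 : e 0 = 1 := by simp [e]
  have he1 : e 1 = 1 := by simp [e]
  have hsurj : Function.Surjective e := fun z => by
    by_cases hz : 0 ≤ Complex.arg z
    · refine ⟨⟨Complex.arg z / (2 * Real.pi), by positivity, ?_⟩, ?_⟩
      · rw [div_le_one (by positivity)]
        linarith [Complex.arg_le_pi z, Real.pi_pos]
      · simp only [e]
        rw [mul_div_cancel₀ _ (by positivity), Circle.exp_arg]
    · refine ⟨⟨Complex.arg z / (2 * Real.pi) + 1, ?_, ?_⟩, ?_⟩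
      · rw [← sub_neg_eq_add, sub_nonneg, le_div_iff₀ (by positivity)]
        linarith [Complex.neg_pi_lt_arg z, Real.pi_pos]
      · have : Complex.arg z / (2 * Real.pi) ≤ 0 :=
          div_nonpos_of_nonpos_of_nonneg (le_of_not_ge hz) (by positivity)
        linarith
      · simp only [e]
        rw [mul_add, mul_div_cancel₀ _ (by positivity), mul_one, Circle.exp_add_two_pi,
          Circle.exp_arg]
  have hinj : ∀ s t, e s = e t → s = t ∨ (s = 0 ∧ t = 1) ∨ (s = 1 ∧ t = 0) := fun s t hst => by
    obtain ⟨m, hm⟩ := Circle.exp_eq_exp.1 hst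
    have hpi := Real.pi_pos
    have hst' : (s : ℝ) = t + m := by
      have : (2 * Real.pi) * (s : ℝ) = (2 * Real.pi) * (t + m) := by rw [hm]; ring
      exact mul_left_cancel₀ (by positivity) this
    have hs := s.2
    have ht := t.2
    have hm1 : m < 2 := by
      have : (m : ℝ) < 2 := by linarith [hs.2, ht.1]
      exact_mod_cast this
    have hm2 : -2 < m := by
      have : (-2 : ℝ) < m := by linarith [hs.1, ht.2]
      exact_mod_cast this
    obtain rfl | rfl | rfl : m = -1 ∨ m = 0 ∨ m = 1 := by omega
    · refine Or.inr (Or.inl ⟨Subtype.ext ?_, Subtype.ext ?_⟩) <;> push_cast at * <;>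
        linarith [hs.1, ht.2]
    · exact Or.inl (Subtype.ext (by simpa using hst'))
    · refine Or.inr (Or.inr ⟨Subtype.ext ?_, Subtype.ext ?_⟩) <;> push_cast at * <;>
        linarith [hs.2, ht.1]
  obtain ⟨l, hl, hlz, hl01⟩ := exists_log_loop hf h0
    (⟨⟨fun t => c (e t), by fun_prop⟩, congrArg c he0, congrArg c he1⟩ : Path (c 1) (c 1))
  have hq : Topology.IsQuotientMap e := Topology.IsQuotientMap.of_surjective_continuous hsurj he
  obtain ⟨r, hr⟩ := hsurj.hasRightInverse
  have hlr : ∀ t, l (r (e t)) = l t := fun t => by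
    rcases hinj _ _ (hr (e t)) with h | ⟨h, h'⟩ | ⟨h, h'⟩
    · rw [h]
    · rw [h, h', hl01]
    · rw [h, h', hl01]
  refine ⟨fun z => l (r z), ?_, fun z => ?_⟩
  · rw [hq.continuous_iff]
    convert hl using 1
    exact funext hlr
  · rw [hlz]
    exact congrArg (fun z => f (c z)) (hr z)

theorem HasContinuousLog.of_loop_in_simplyConnected {X : Type*} [TopologicalSpace X]
    [SimplyConnectedSpace X] {j : X → ℂ} (hj : Continuous j) {w : ℂ} (hw : ∀ x, j x ≠ w)
    {c : Circle → X} (hc : Continuous c) (hinj : Function.Injective (j ∘ c)) :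
    HasContinuousLog (Set.range (j ∘ c)) w := by
  obtain ⟨l, hl, hlz⟩ := exists_log_circle (f := fun x => j x - w) (by fun_prop)
    (fun x => sub_ne_zero.2 (hw x)) hc
  have hemb : Topology.IsEmbedding (j ∘ c) :=
    ((hj.comp hc).isClosedEmbedding hinj).isEmbedding
  refine ⟨fun z => l (Function.invFun (j ∘ c) z), ?_, ?_⟩
  · rw [← Set.image_univ, hemb.isInducing.continuousOn_image_iff, continuousOn_univ]
    convert hl using 1
    exact funext fun z => congrArg l (Function.leftInverse_invFun hinj z)
  · rintro _ ⟨z, rfl⟩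
    exact (congrArg (fun z => Complex.exp (l z)) (Function.leftInverse_invFun hinj z)).trans
      (hlz z)

theorem Circle.isPreconnected_compl {X : Set Circle} (hX : IsPreconnected X) :
    IsPreconnected Xᶜ := by
  by_cases hne : ∃ y, y ∉ X
  swap
  · push Not at hne
    rw [Set.eq_univ_of_forall hne, Set.compl_univ]
    exact isPreconnected_empty
  obtain ⟨y, hy⟩ := hne
  let e : ℝ → Circle := fun t => y * Circle.exp Real.pi * Circle.exp t
  have he : Continuous e := by fun_prop
  have hpi := Real.pi_pos
  have he1 : e Real.pi = y := by
    simp only [e]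
    rw [mul_assoc, ← Circle.exp_add, ← two_mul, Circle.exp_two_pi, mul_one]
  have he2 : e (-Real.pi) = y := by
    simp only [e]
    rw [mul_assoc, ← Circle.exp_add, add_neg_cancel, Circle.exp_zero, mul_one]
  let a : Circle → ℝ := fun z => Complex.arg ((y * Circle.exp Real.pi)⁻¹ * z : Circle)
  have hea : ∀ z, e (a z) = z := fun z => by
    simp only [e, a, Circle.exp_arg, mul_inv_cancel_left]
  have hane : ∀ z ∈ X, a z ≠ Real.pi := fun z hz h => hy (by rwa [← he1, ← h, hea])
  have ha : ContinuousOn a X := fun z hz => by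
    refine ContinuousAt.continuousWithinAt ?_
    refine ContinuousAt.comp (f := fun z : Circle => (((y * Circle.exp Real.pi)⁻¹ * z : Circle) : ℂ))
      (Complex.continuousAt_arg ?_) (by fun_prop)
    exact Complex.mem_slitPlane_iff_arg.2 ⟨hane z hz, Circle.coe_ne_zero _⟩
  have haIoo : ∀ z ∈ X, a z ∈ Set.Ioo (-Real.pi) Real.pi := fun z hz =>
    ⟨Complex.neg_pi_lt_arg _, lt_of_le_of_ne (Complex.arg_le_pi _) (hane z hz)⟩
  have hae : ∀ t ∈ Set.Ioo (-Real.pi) Real.pi, a (e t) = t := fun t ht => by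
    simp only [e, a, inv_mul_cancel_left]
    exact Circle.arg_exp ht.1 ht.2.le
  have haX : ∀ t ∈ Set.Icc (-Real.pi) Real.pi, e t ∈ X → t ∈ a '' X := fun t ht htX => by
    refine ⟨e t, htX, hae t ⟨lt_of_le_of_ne ht.1 ?_, lt_of_le_of_ne ht.2 ?_⟩⟩
    · rintro rfl
      exact hy (he2 ▸ htX)
    · rintro rfl
      exact hy (he1 ▸ htX)
  have hoc : (a '' X).OrdConnected := (hX.image a ha).ordConnected
  have himg : Xᶜ = e '' {t | t ∈ Set.Icc (-Real.pi) Real.pi ∧ ∀ x ∈ a '' X, t < x} ∪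
      e '' {t | t ∈ Set.Icc (-Real.pi) Real.pi ∧ ∀ x ∈ a '' X, x < t} := by
    ext z
    constructor
    · intro hz
      have hIcc : a z ∈ Set.Icc (-Real.pi) Real.pi :=
        ⟨(Complex.neg_pi_lt_arg _).le, Complex.arg_le_pi _⟩
      have haz : a z ∉ a '' X := by
        rintro ⟨x, hx, hxz⟩
        exact hz (by rwa [← hea z, ← hxz, hea])
      by_cases h : ∀ x ∈ a '' X, a z < x
      · exact Or.inl ⟨a z, ⟨hIcc, h⟩, hea z⟩
      · push Not at h
        obtain ⟨x, hx, hxz⟩ := h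
        refine Or.inr ⟨a z, ⟨hIcc, fun x' hx' => ?_⟩, hea z⟩
        by_contra! hcon
        exact haz (hoc.out hx hx' ⟨hxz, hcon⟩)
    · rintro (⟨t, ⟨ht, htX⟩, rfl⟩ | ⟨t, ⟨ht, htX⟩, rfl⟩) <;>
        exact fun h => lt_irrefl _ (htX t (haX t ht h))
  rw [himg]
  refine IsPreconnected.union y ⟨-Real.pi, ⟨⟨le_rfl, by linarith⟩, ?_⟩, he2⟩
    ⟨Real.pi, ⟨⟨by linarith, le_rfl⟩, ?_⟩, he1⟩ ?_ ?_
  · rintro _ ⟨z, hz, rfl⟩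
    exact (haIoo z hz).1
  · rintro _ ⟨z, hz, rfl⟩
    exact (haIoo z hz).2
  · refine IsPreconnected.image (Set.OrdConnected.isPreconnected ⟨?_⟩) _ he.continuousOn
    exact fun u hu v hv t ht => ⟨⟨hu.1.1.trans ht.1, ht.2.trans hv.1.2⟩,
      fun x hx => ht.2.trans_lt (hv.2 x hx)⟩
  · refine IsPreconnected.image (Set.OrdConnected.isPreconnected ⟨?_⟩) _ he.continuousOn
    exact fun u hu v hv t ht => ⟨⟨hu.1.1.trans ht.1, ht.2.trans hv.1.2⟩,
      fun x hx => (hu.2 x hx).trans_le ht.1⟩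

/-- If `z - w` has a continuous logarithm on `K` for both points `w = p ± iδv`, then the change of
`log ((z - (p - iδv)) / (z - (p + iδv)))` along an arc crossing the segment between these two points
agrees with the change along a connected part of `K` far away from it. -/
theorem log_change_arc_eq_log_change_compl {K β : Set ℂ} {γ : ℝ → ℂ} {p v : ℂ} (hv : v ≠ 0)
    {s t₀ t : ℝ} (hs : s < t₀) (ht : t₀ < t) (hγ : ContinuousOn γ (Set.Icc s t))
    (hγK : ∀ u ∈ Set.Icc s t, γ u ∈ K)
    (hcone : ∀ u ∈ Set.Icc s t, ‖(γ u - p) / v - (u - t₀ : ℝ)‖ ≤ |u - t₀| / 2)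
    (hβ : IsPreconnected β) (hβK : β ⊆ K) (hsβ : γ s ∈ β) (htβ : γ t ∈ β) {c δ : ℝ}
    (hc : ∀ z ∈ β, c ≤ ‖(z - p) / v‖) (hδ : 0 < δ) (hδc : δ < c)
    (h₁ : HasContinuousLog K (p - Complex.I * δ * v))
    (h₂ : HasContinuousLog K (p + Complex.I * δ * v)) :
    (Complex.log (δ - Complex.I * ((γ t - p) / v)) - Complex.log (δ + Complex.I * ((γ t - p) / v)))
      - (Complex.log (δ - Complex.I * ((γ s - p) / v)) -
        Complex.log (δ + Complex.I * ((γ s - p) / v))) =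
    (Complex.log (1 + Complex.I * δ / ((γ t - p) / v)) -
        Complex.log (1 - Complex.I * δ / ((γ t - p) / v))) -
      (Complex.log (1 + Complex.I * δ / ((γ s - p) / v)) -
        Complex.log (1 - Complex.I * δ / ((γ s - p) / v))) := by
  obtain ⟨g₁, hg₁, hg₁e⟩ := h₁
  obtain ⟨g₂, hg₂, hg₂e⟩ := h₂
  have hδ' : (δ : ℂ) ≠ 0 := by exact_mod_cast hδ.ne'
  have hquot : ∀ z ∈ K, Complex.exp (g₁ z - g₂ z) =
      ((z - p) / v + Complex.I * δ) / ((z - p) / v - Complex.I * δ) := fun z hz => by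
    rw [Complex.exp_sub, hg₁e z hz, hg₂e z hz, div_add' _ _ _ hv, div_sub' hv,
      div_div_div_cancel_right₀ hv]
    congr 1 <;> ring
  have hsI : s ∈ Set.Icc s t := ⟨le_rfl, (hs.trans ht).le⟩
  have htI : t ∈ Set.Icc s t := ⟨(hs.trans ht).le, le_rfl⟩
  have hslit : ∀ u ∈ Set.Icc s t, (δ - Complex.I * ((γ u - p) / v) : ℂ) ∈ Complex.slitPlane ∧
      (δ + Complex.I * ((γ u - p) / v) : ℂ) ∈ Complex.slitPlane := fun u hu => by
    have hre : |((γ u - p) / v).re - (u - t₀)| ≤ |u - t₀| / 2 := by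
      refine le_trans ?_ (hcone u hu)
      simpa using Complex.abs_re_le_norm ((γ u - p) / v - (u - t₀ : ℝ))
    by_cases h0 : u = t₀
    · have := hcone u hu
      rw [h0] at this ⊢
      simp only [sub_self, Complex.ofReal_zero, sub_zero, abs_zero, zero_div,
        norm_le_zero_iff] at this
      rw [this]
      simp [hδ]
    · have hne : ((γ u - p) / v).re ≠ 0 := fun h => by
        rw [h, zero_sub, abs_neg] at hre
        have := abs_pos.2 (sub_ne_zero.2 h0)
        linarith
      constructor <;> exact Or.inr (by simpa using hne)
  have harc := isPreconnected_Icc.sub_eq_sub_of_exp_eq (s := Set.Icc s t)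
    (f := fun u => g₁ (γ u) - g₂ (γ u))
    (g := fun u => Complex.log (δ - Complex.I * ((γ u - p) / v)) -
      Complex.log (δ + Complex.I * ((γ u - p) / v)) + Real.pi * Complex.I)
    ((hg₁.comp hγ hγK).sub (hg₂.comp hγ hγK))
    (((ContinuousOn.clog (by fun_prop) fun u hu => (hslit u hu).1).sub
      (ContinuousOn.clog (by fun_prop) fun u hu => (hslit u hu).2)).add continuousOn_const)
    (fun u hu => by
      have n₁ := Complex.slitPlane_ne_zero (hslit u hu).1
      have n₂ := Complex.slitPlane_ne_zero (hslit u hu).2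
      rw [hquot _ (hγK u hu), Complex.exp_add, Complex.exp_sub, Complex.exp_log n₁,
        Complex.exp_log n₂, Complex.exp_pi_mul_I]
      generalize (γ u - p) / v = ζ at *
      have n₃ : ζ - Complex.I * δ ≠ 0 := fun h => n₂ (by
        rw [sub_eq_zero.1 h, ← mul_assoc, Complex.I_mul_I]
        ring)
      rw [div_mul_eq_mul_div, div_eq_div_iff n₃ n₂]
      linear_combination (2 * ζ * δ) * Complex.I_sq) hsI htI
  have hsm : ∀ z ∈ β, (z - p) / v ≠ 0 ∧ ‖Complex.I * δ / ((z - p) / v)‖ < 1 := fun z hz => by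
    have hpos : 0 < ‖(z - p) / v‖ := (hδ.trans hδc).trans_le (hc z hz)
    refine ⟨norm_pos_iff.1 hpos, ?_⟩
    rw [norm_div, div_lt_one hpos]
    simpa [abs_of_pos hδ] using hδc.trans_le (hc z hz)
  have hslit' : ∀ z ∈ β, 1 + Complex.I * δ / ((z - p) / v) ∈ Complex.slitPlane ∧
      1 - Complex.I * δ / ((z - p) / v) ∈ Complex.slitPlane := fun z hz =>
    ⟨Complex.mem_slitPlane_of_norm_lt_one (hsm z hz).2, by
      rw [sub_eq_add_neg]
      exact Complex.mem_slitPlane_of_norm_lt_one (by rw [norm_neg]; exact (hsm z hz).2)⟩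
  have hζc : ContinuousOn (fun z => Complex.I * δ / ((z - p) / v)) β :=
    continuousOn_const.div (by fun_prop) fun z hz => (hsm z hz).1
  have hfar := hβ.sub_eq_sub_of_exp_eq
    (f := fun z => g₁ z - g₂ z)
    (g := fun z => Complex.log (1 + Complex.I * δ / ((z - p) / v)) -
      Complex.log (1 - Complex.I * δ / ((z - p) / v)))
    ((hg₁.mono hβK).sub (hg₂.mono hβK))
    ((ContinuousOn.clog (continuousOn_const.add hζc) fun z hz => (hslit' z hz).1).sub
      (ContinuousOn.clog (continuousOn_const.sub hζc) fun z hz => (hslit' z hz).2))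
    (fun z hz => by
      have n₁ := Complex.slitPlane_ne_zero (hslit' z hz).1
      have n₂ := Complex.slitPlane_ne_zero (hslit' z hz).2
      have n₀ := (hsm z hz).1
      rw [hquot _ (hβK hz), Complex.exp_sub, Complex.exp_log n₁, Complex.exp_log n₂]
      generalize (z - p) / v = ζ at *
      rw [one_add_div n₀, one_sub_div n₀, div_div_div_cancel_right₀ n₀]) hsβ htβ
  rw [hfar] at harc
  rw [harc]
  ring

theorem log_jump_ne {ζ₁ ζ₂ : ℂ} (h₁ : ζ₁.re < 0) (h₂ : 0 < ζ₂.re) :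
    ¬ ∀ᶠ δ : ℝ in nhdsWithin 0 (Set.Ioi 0),
      (Complex.log (δ - Complex.I * ζ₂) - Complex.log (δ + Complex.I * ζ₂)) -
        (Complex.log (δ - Complex.I * ζ₁) - Complex.log (δ + Complex.I * ζ₁)) =
      (Complex.log (1 + Complex.I * δ / ζ₂) - Complex.log (1 - Complex.I * δ / ζ₂)) -
        (Complex.log (1 + Complex.I * δ / ζ₁) - Complex.log (1 - Complex.I * δ / ζ₁)) := by
  intro hev
  have hc : ∀ ζ : ℂ, ζ.re ≠ 0 → ContinuousAt (fun δ : ℝ =>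
      (Complex.log (δ - Complex.I * ζ) - Complex.log (δ + Complex.I * ζ))) 0 := fun ζ hζ => by
    refine (ContinuousAt.clog (by fun_prop) (Or.inr ?_)).sub
      (ContinuousAt.clog (by fun_prop) (Or.inr ?_)) <;> simpa using hζ
  have hc' : ∀ ζ : ℂ, ContinuousAt (fun δ : ℝ =>
      (Complex.log (1 + Complex.I * δ / ζ) - Complex.log (1 - Complex.I * δ / ζ))) 0 := fun ζ => by
    refine (ContinuousAt.clog (by fun_prop) ?_).sub
      (ContinuousAt.clog (by fun_prop) ?_) <;> simp
  have e := tendsto_nhds_unique_of_eventuallyEq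
    ((((hc ζ₂ h₂.ne').sub (hc ζ₁ h₁.ne)).tendsto).mono_left nhdsWithin_le_nhds)
    ((((hc' ζ₂).sub (hc' ζ₁)).tendsto).mono_left nhdsWithin_le_nhds) hev
  have l₂ : Complex.log (-(Complex.I * ζ₂)) = Complex.log (Complex.I * ζ₂) - Real.pi * Complex.I := by
    simp only [Complex.log, norm_neg]
    rw [Complex.arg_neg_eq_arg_sub_pi_of_im_pos (by simpa using h₂)]
    push_cast
    ring
  have l₁ : Complex.log (-(Complex.I * ζ₁)) = Complex.log (Complex.I * ζ₁) + Real.pi * Complex.I := by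
    simp only [Complex.log, norm_neg]
    rw [Complex.arg_neg_eq_arg_add_pi_of_im_neg (by simpa using h₁)]
    push_cast
    ring
  simp only [Pi.sub_apply, Complex.ofReal_zero, zero_sub, zero_add, mul_zero, zero_div, add_zero, sub_zero,
    Complex.log_one, sub_self, l₁, l₂] at e
  have hpi : (Real.pi : ℂ) * Complex.I ≠ 0 := by simp [Real.pi_ne_zero]
  apply hpi
  linear_combination (-1 / 2 : ℂ) * e

/-- Near a point where a Jordan curve is locally a differentiable arc with nonzero velocity there are
points about which the curve has no logarithm. -/
theorem exists_not_hasContinuousLog_near {ψ : Circle → ℂ} (hψ : Continuous ψ)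
    (hψi : Function.Injective ψ) {γ : ℝ → ℂ} {a b : ℝ} (hγ : ContinuousOn γ (Set.Icc a b))
    (hγi : Set.InjOn γ (Set.Icc a b)) (hγK : ∀ u ∈ Set.Icc a b, γ u ∈ Set.range ψ) {t₀ : ℝ}
    (ht₀ : t₀ ∈ Set.Ioo a b) {v : ℂ} (hv : v ≠ 0) (hd : HasDerivAt γ v t₀) {r : ℝ} (hr : 0 < r)
    (hloc : Set.range ψ ∩ Metric.ball (γ t₀) r ⊆ γ '' Set.Icc a b) {ε : ℝ} (hε : 0 < ε) :
    ∃ w ∉ Set.range ψ, dist w (γ t₀) < ε ∧ ¬ HasContinuousLog (Set.range ψ) w := by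
  by_contra! hcon
  set K := Set.range ψ with hK
  set p := γ t₀ with hp
  have hvpos : 0 < ‖v‖ := norm_pos_iff.2 hv
  obtain ⟨η, hη, hcone⟩ : ∃ η > 0, ∀ u : ℝ, |u - t₀| < η →
      ‖(γ u - p) / v - (u - t₀ : ℝ)‖ ≤ |u - t₀| / 2 := by
    have := (hasDerivAt_iff_isLittleO.1 hd).def (c := ‖v‖ / 2) (by positivity)
    obtain ⟨η, hη, h⟩ := Metric.eventually_nhds_iff.1 this
    refine ⟨η, hη, fun u hu => ?_⟩
    have h' := h (y := u) (by rwa [Real.dist_eq])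
    have e : (γ u - p) / v - (u - t₀ : ℝ) = (γ u - γ t₀ - (u - t₀) • v) / v := by
      rw [Complex.real_smul]
      field_simp
      ring
    rw [e, norm_div, div_le_iff₀ hvpos]
    rw [Real.norm_eq_abs] at h'
    linarith
  obtain ⟨s, hsa, hs, hsη⟩ : ∃ s, a ≤ s ∧ s < t₀ ∧ t₀ - s < η :=
    ⟨max a (t₀ - η / 2), le_max_left _ _, max_lt ht₀.1 (by linarith),
      by linarith [le_max_right a (t₀ - η / 2)]⟩
  obtain ⟨t, htb, ht, htη⟩ : ∃ t, t ≤ b ∧ t₀ < t ∧ t - t₀ < η :=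
    ⟨min b (t₀ + η / 2), min_le_left _ _, lt_min ht₀.2 (by linarith),
      by linarith [min_le_right b (t₀ + η / 2)]⟩
  have hsub : Set.Icc s t ⊆ Set.Icc a b := Set.Icc_subset_Icc hsa htb
  have hcone' : ∀ u ∈ Set.Icc s t, ‖(γ u - p) / v - (u - t₀ : ℝ)‖ ≤ |u - t₀| / 2 := fun u hu =>
    hcone u (abs_lt.2 ⟨by linarith [hu.1], by linarith [hu.2]⟩)
  set β := K \ γ '' Set.Ioo s t with hβ
  have hemb : Topology.IsEmbedding ψ := (hψ.isClosedEmbedding hψi).isEmbedding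
  have hIooK : γ '' Set.Ioo s t ⊆ K := by
    rintro _ ⟨u, hu, rfl⟩
    exact hγK u (hsub (Set.Ioo_subset_Icc_self hu))
  have hβc : IsPreconnected β := by
    have : β = ψ '' (ψ ⁻¹' (γ '' Set.Ioo s t))ᶜ := by
      rw [Set.image_compl_eq_range_sdiff_image hψi, Set.image_preimage_eq_of_subset hIooK]
    rw [this]
    refine (Circle.isPreconnected_compl ?_).image _ hψ.continuousOn
    rw [← hemb.isInducing.isPreconnected_image, Set.image_preimage_eq_of_subset hIooK]
    exact isPreconnected_Ioo.image _ (hγ.mono (Set.Ioo_subset_Icc_self.trans hsub))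
  have hsI : s ∈ Set.Icc s t := ⟨le_rfl, (hs.trans ht).le⟩
  have htI : t ∈ Set.Icc s t := ⟨(hs.trans ht).le, le_rfl⟩
  have hsβ : γ s ∈ β := by
    refine ⟨hγK s (hsub hsI), ?_⟩
    rintro ⟨u, hu, hus⟩
    exact hu.1.ne' (hγi (hsub (Set.Ioo_subset_Icc_self hu)) (hsub hsI) hus)
  have htβ : γ t ∈ β := by
    refine ⟨hγK t (hsub htI), ?_⟩
    rintro ⟨u, hu, hut⟩
    exact hu.2.ne (hγi (hsub (Set.Ioo_subset_Icc_self hu)) (hsub htI) hut)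
  obtain ⟨d, hd0, hdβ⟩ : ∃ d > 0, ∀ z ∈ β, d ≤ dist z p := by
    have hC : IsClosed (γ '' (Set.Icc a b \ Set.Ioo s t)) :=
      ((isCompact_Icc.diff isOpen_Ioo).image_of_continuousOn (hγ.mono Set.sdiff_subset)).isClosed
    have hpC : p ∈ (γ '' (Set.Icc a b \ Set.Ioo s t))ᶜ := by
      rintro ⟨u, hu, hup⟩
      have := hγi hu.1 (Set.Ioo_subset_Icc_self ht₀) hup
      exact hu.2 (this ▸ ⟨hs, ht⟩)
    obtain ⟨d, hd, hdC⟩ := Metric.isOpen_iff.1 hC.isOpen_compl p hpC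
    refine ⟨min d r, lt_min hd hr, fun z hz => ?_⟩
    by_contra! hlt
    obtain ⟨u, hu, rfl⟩ := hloc ⟨hz.1, hlt.trans_le (min_le_right _ _)⟩
    exact hdC (hlt.trans_le (min_le_left _ _))
      ⟨u, ⟨hu, fun h => hz.2 ⟨u, h, rfl⟩⟩, rfl⟩
  have hre : ∀ u ∈ Set.Icc s t, |((γ u - p) / v).re - (u - t₀)| ≤ |u - t₀| / 2 := fun u hu => by
    refine le_trans ?_ (hcone' u hu)
    simpa using Complex.abs_re_le_norm ((γ u - p) / v - (u - t₀ : ℝ))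
  have hnotK : ∀ δ : ℝ, δ ≠ 0 → |δ| * ‖v‖ < d → p + Complex.I * δ * v ∉ K := by
    intro δ hδ hδd hmem
    have hz : p + Complex.I * δ * v ∉ β := fun h => by
      have := hdβ _ h
      rw [dist_eq_norm, add_sub_cancel_left, norm_mul, norm_mul, Complex.norm_I, one_mul,
        Complex.norm_real, Real.norm_eq_abs] at this
      linarith
    have : p + Complex.I * δ * v ∈ γ '' Set.Ioo s t := by
      by_contra h
      exact hz ⟨hmem, h⟩
    obtain ⟨u, hu, hup⟩ := this
    have hζ : (γ u - p) / v = Complex.I * δ := by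
      rw [hup, add_sub_cancel_left, mul_div_cancel_right₀ _ hv]
    have h1 := hre u (Set.Ioo_subset_Icc_self hu)
    rw [hζ] at h1
    have hut : u = t₀ := by
      by_contra hne
      have := abs_pos.2 (sub_ne_zero.2 hne)
      simp only [Complex.mul_re, Complex.I_re, zero_mul, Complex.I_im, Complex.ofReal_im, mul_zero,
        sub_zero, zero_sub, abs_neg] at h1
      linarith
    rw [hut, ← hp, sub_self, zero_div] at hζ
    have : Complex.I * (δ : ℂ) ≠ 0 := mul_ne_zero Complex.I_ne_zero (by exact_mod_cast hδ)
    exact this hζ.symm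
  have hlog : ∀ δ : ℝ, δ ≠ 0 → |δ| * ‖v‖ < d → |δ| * ‖v‖ < ε →
      HasContinuousLog K (p + Complex.I * δ * v) := fun δ h0 h1 h2 => by
    refine hcon _ (hnotK δ h0 h1) ?_
    rwa [dist_eq_norm, add_sub_cancel_left, norm_mul, norm_mul, Complex.norm_I, one_mul,
        Complex.norm_real, Real.norm_eq_abs]
  refine log_jump_ne (ζ₁ := (γ s - p) / v) (ζ₂ := (γ t - p) / v) ?_ ?_ ?_
  · have := hre s hsI
    rw [abs_of_neg (sub_neg.2 hs), abs_le] at this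
    linarith [this.2]
  · have := hre t htI
    rw [abs_of_pos (sub_pos.2 ht), abs_le] at this
    linarith [this.1]
  · have hmin : 0 < min d ε / ‖v‖ := by positivity
    filter_upwards [Ioo_mem_nhdsGT hmin] with δ hδ
    have hδm : δ * ‖v‖ < min d ε := (lt_div_iff₀ hvpos).1 hδ.2
    have h1 := hδm.trans_le (min_le_left _ _)
    have h2 := hδm.trans_le (min_le_right _ _)
    refine log_change_arc_eq_log_change_compl hv hs ht (hγ.mono hsub)
      (fun u hu => hγK u (hsub hu)) hcone' hβc Set.sdiff_subset hsβ htβ (c := d / ‖v‖)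
      (fun z hz => ?_) hδ.1 ((lt_div_iff₀ hvpos).2 h1) ?_ ?_
    · rw [norm_div]
      gcongr
      rw [← dist_eq_norm]
      exact hdβ z hz
    · have := hlog (-δ) (neg_ne_zero.2 hδ.1.ne') (by rwa [abs_neg, abs_of_pos hδ.1])
        (by rwa [abs_neg, abs_of_pos hδ.1])
      convert this using 1
      push_cast
      ring
    · exact hlog δ hδ.1.ne' (by rwa [abs_of_pos hδ.1]) (by rwa [abs_of_pos hδ.1])

theorem edist_le_pathEDist {X : Type*} [PseudoEMetricSpace X] (x y : X) :
    edist x y ≤ pathEDist x y := by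
  refine le_iInf fun c => ?_
  have := eVariationOn.edist_le (fun t : unitInterval => c t) (Set.mem_univ 0) (Set.mem_univ 1)
  simpa [pathLength] using this

theorem pathEDist_self {X : Type*} [PseudoEMetricSpace X] (x : X) : pathEDist x x = 0 := by
  refine le_antisymm (iInf_le_of_le (Path.refl x) ?_) bot_le
  exact (eVariationOn.constant_on (by rintro _ ⟨_, _, rfl⟩ _ ⟨_, _, rfl⟩; rfl)).le

theorem pathEDist_le_of_segment_subset {V : Type*} [NormedAddCommGroup V] [NormedSpace ℝ V]
    {E : Set V} {x y : E} (h : segment ℝ (x : V) y ⊆ E) :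
    pathEDist x y ≤ edist (x : V) y := by
  have hmem : ∀ t : unitInterval, AffineMap.lineMap (x : V) (y : V) (t : ℝ) ∈ E := fun t =>
    h (by rw [segment_eq_image_lineMap]; exact ⟨t, t.2, rfl⟩)
  let c : Path x y :=
    { toFun := fun t => ⟨AffineMap.lineMap (x : V) (y : V) (t : ℝ), hmem t⟩
      continuous_toFun := by
        refine Continuous.subtype_mk ?_ _
        exact AffineMap.lineMap_continuous.comp continuous_subtype_val
      source' := by simp
      target' := by simp }
  refine (iInf_le _ c).trans ?_
  have hlip : LipschitzWith (nndist (x : V) y) fun t : unitInterval => c t := by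
    refine LipschitzWith.of_dist_le_mul fun s t => ?_
    rw [Subtype.dist_eq]
    change dist (AffineMap.lineMap (x : V) (y : V) (s : ℝ)) (AffineMap.lineMap (x : V) (y : V) (t : ℝ))
      ≤ _
    rw [dist_lineMap_lineMap, coe_nndist, mul_comm, Subtype.dist_eq]
  have h1 := hlip.lipschitzOnWith (s := Set.univ) |>.comp_eVariationOn_le
    (g := fun t : unitInterval => t) (s := Set.univ) (Set.mapsTo_univ _ _)
  have h2 : eVariationOn (fun t : unitInterval => t) Set.univ ≤ 1 := by
    have h3 : eVariationOn (fun t : unitInterval => (t : ℝ)) Set.univ ≤ 1 := by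
      have := (Subtype.mono_coe (· ∈ unitInterval)).monotoneOn Set.univ |>.eVariationOn_eq
        (a := (0 : unitInterval)) (b := 1) (Set.mem_univ _) (Set.mem_univ _)
      refine le_trans (eVariationOn.mono _ ?_) (this.le.trans (by simp))
      exact fun t _ => ⟨Set.mem_univ _, t.2.1, t.2.2⟩
    exact h3
  calc pathLength c ≤ nndist (x : V) y * eVariationOn (fun t : unitInterval => t) Set.univ := h1
    _ ≤ nndist (x : V) y * 1 := by gcongr
    _ = edist (x : V) y := by rw [mul_one, edist_nndist]

namespace IsGeodesicSegment

theorem injOn {X : Type*} [MetricSpace X] {γ : ℝ → X} {D : ℝ} {x y : X}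
    (h : IsGeodesicSegment γ D x y) : Set.InjOn γ (Set.Icc 0 D) := fun s hs t ht hst => by
  have := h.2.2 s hs t ht
  rw [hst, pathEDist_self, eq_comm, ENNReal.ofReal_eq_zero] at this
  exact sub_eq_zero.1 (abs_nonpos_iff.1 this)

theorem dist_le {X : Type*} [MetricSpace X] {γ : ℝ → X} {D : ℝ} {x y : X}
    (h : IsGeodesicSegment γ D x y) {s t : ℝ} (hs : s ∈ Set.Icc 0 D) (ht : t ∈ Set.Icc 0 D) :
    dist (γ s) (γ t) ≤ |s - t| := by
  have := (edist_le_pathEDist (γ s) (γ t)).trans (h.2.2 s hs t ht).le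
  rwa [edist_dist, ENNReal.ofReal_le_ofReal_iff (abs_nonneg _)] at this

theorem lipschitzOnWith {X : Type*} [MetricSpace X] {γ : ℝ → X} {D : ℝ} {x y : X}
    (h : IsGeodesicSegment γ D x y) : LipschitzOnWith 1 γ (Set.Icc 0 D) :=
  LipschitzOnWith.of_dist_le_mul fun s hs t ht => by
    simpa [Real.dist_eq] using h.dist_le hs ht

/-- If the straight segment between two distinct points of a geodesic of the path metric lies
in `E`, then the geodesic passes through the interior of this segment. -/
theorem exists_mem_openSegment {V : Type*} [NormedAddCommGroup V] [NormedSpace ℝ V]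
    [StrictConvexSpace ℝ V] {E : Set V} {γ : ℝ → E} {D : ℝ} {x y : E}
    (h : IsGeodesicSegment γ D x y) {s t : ℝ} (hs : s ∈ Set.Icc 0 D) (ht : t ∈ Set.Icc 0 D)
    (hst : s < t) (hseg : segment ℝ (γ s : V) (γ t) ⊆ E) :
    ∃ u ∈ Set.Icc 0 D, (γ u : V) ∈ openSegment ℝ (γ s : V) (γ t) := by
  have hlen : t - s ≤ dist (γ s : V) (γ t) := by
    have := (h.2.2 s hs t ht).symm.le.trans (pathEDist_le_of_segment_subset hseg)
    rw [edist_dist, ENNReal.ofReal_le_ofReal_iff dist_nonneg, abs_sub_comm,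
      abs_of_pos (sub_pos.2 hst)] at this
    exact this
  set u := (s + t) / 2 with hu_def
  have hu : u ∈ Set.Icc 0 D := ⟨by linarith [hs.1, ht.1], by linarith [hs.2, ht.2]⟩
  have h1 : dist (γ s : V) (γ u) ≤ (t - s) / 2 := by
    refine (h.dist_le hs hu).trans (le_of_eq ?_)
    rw [abs_of_neg (by linarith), hu_def]; ring
  have h2 : dist (γ u : V) (γ t) ≤ (t - s) / 2 := by
    refine (h.dist_le hu ht).trans (le_of_eq ?_)
    rw [abs_of_neg (by linarith), hu_def]; ring
  have h3 := dist_triangle (γ s : V) (γ u) (γ t)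
  refine ⟨u, hu, ?_⟩
  have hw : Wbtw ℝ (γ s : V) (γ u) (γ t) := dist_add_dist_eq_iff.1 (by linarith)
  refine mem_openSegment_of_ne_left_right ?_ ?_ hw.mem_segment
  · intro he
    rw [← he] at h2
    linarith
  · intro he
    rw [← he] at h1
    linarith

end IsGeodesicSegment

/-- An injective Lipschitz curve has nonzero velocity at a dense set of times. -/
theorem exists_hasDerivAt_ne_zero {V : Type*} [NormedAddCommGroup V] [NormedSpace ℝ V]
    [FiniteDimensional ℝ V] {γ : ℝ → V} {a b : ℝ} (hab : a < b)
    (hl : LipschitzOnWith 1 γ (Set.Icc a b)) (hi : Set.InjOn γ (Set.Icc a b)) :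
    ∃ t ∈ Set.Ioo a b, ∃ v ≠ 0, HasDerivAt γ v t := by
  by_contra! hcon
  have hd : ∀ᵐ x : ℝ, x ∈ Set.Ioo a b → DifferentiableAt ℝ γ x := by
    filter_upwards [hl.ae_differentiableWithinAt_of_mem_real] with x hx hxI
    exact (hx (Set.Ioo_subset_Icc_self hxI)).differentiableAt (Icc_mem_nhds hxI.1 hxI.2)
  obtain ⟨C, hC⟩ := AbsolutelyContinuousOnInterval.const_of_ae_hasDerivAt_zero
    (f := γ) (a := a) (b := b)
    (LipschitzOnWith.absolutelyContinuousOnInterval (by rwa [Set.uIcc_of_le hab.le])) (by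
      have hne : ∀ c : ℝ, ∀ᵐ x : ℝ, x ≠ c := fun c => by
        simp [MeasureTheory.ae_iff]
      filter_upwards [hd, hne a, hne b] with x hx hxa hxb hxI
      rw [Set.uIcc_of_le hab.le] at hxI
      have hxI' : x ∈ Set.Ioo a b := ⟨lt_of_le_of_ne hxI.1 hxa.symm, lt_of_le_of_ne hxI.2 hxb⟩
      have h' := (hx hxI').hasDerivAt
      by_cases h0 : deriv γ x = 0
      · rwa [h0] at h'
      · exact absurd h' (hcon x hxI' _ h0))
  rw [Set.uIcc_of_le hab.le] at hC
  have ha : a ∈ Set.Icc a b := ⟨le_rfl, hab.le⟩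
  have hb : b ∈ Set.Icc a b := ⟨hab.le, le_rfl⟩
  exact hab.ne (hi ha hb ((hC a ha).trans (hC b hb).symm))

theorem isBounded_connectedComponentIn_image {V W : Type*} [SeminormedAddCommGroup V]
    [SeminormedAddCommGroup W] [Module ℝ V] [Module ℝ W] (e : V ≃ₗᵢ[ℝ] W) {K : Set V} {w : V}
    (hw : w ∉ K) :
    Bornology.IsBounded (connectedComponentIn (e '' K)ᶜ (e w)) ↔
      Bornology.IsBounded (connectedComponentIn Kᶜ w) := by
  have h : e '' connectedComponentIn Kᶜ w = connectedComponentIn (e '' K)ᶜ (e w) := by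
    rw [← Set.image_compl_eq e.bijective]
    exact e.toHomeomorph.image_connectedComponentIn hw
  rw [← h]
  refine ⟨fun hb => ?_, fun hb => e.isometry.lipschitz.isBounded_image hb⟩
  have := e.symm.isometry.lipschitz.isBounded_image hb
  rwa [← Set.image_comp, show (e.symm ∘ e : V → V) = id from funext e.symm_apply_apply,
    Set.image_id] at this

/-- Any open interval inside a segment avoiding a closed set extends to a maximal one. -/
theorem exists_maximal_segment_compl {V : Type*} [NormedAddCommGroup V] [NormedSpace ℝ V]
    {C : Set V} (hC : IsClosed C) {a b z : V} (ha : a ∈ C) (hb : b ∈ C)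
    (hz : z ∈ segment ℝ a b) (hzC : z ∉ C) :
    ∃ a' ∈ C ∩ segment ℝ a b, ∃ b' ∈ C ∩ segment ℝ a b, z ∈ openSegment ℝ a' b' ∧
      Disjoint (openSegment ℝ a' b') C := by
  rw [segment_eq_image_lineMap] at hz ⊢
  obtain ⟨c, hc, rfl⟩ := hz
  set f : ℝ → V := fun t => AffineMap.lineMap a b t with hf
  have hfc : Continuous f := AffineMap.lineMap_continuous
  have hcl : IsClosed (f ⁻¹' C) := hC.preimage hfc
  obtain ⟨s, ⟨hsC, hs⟩, hsmax⟩ := (isCompact_Icc.inter_left hcl).exists_isGreatest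
    (s := f ⁻¹' C ∩ Icc 0 c) ⟨0, by simpa [hf] using ha, le_rfl, hc.1⟩
  obtain ⟨t, ⟨htC, ht⟩, htmin⟩ := (isCompact_Icc.inter_left hcl).exists_isLeast
    (s := f ⁻¹' C ∩ Icc c 1) ⟨1, by simpa [hf] using hb, hc.2, le_rfl⟩
  have hsc : s < c := lt_of_le_of_ne hs.2 fun h => hzC (h ▸ hsC)
  have hct : c < t := lt_of_le_of_ne ht.1 fun h => hzC (h ▸ htC)
  have hopen : openSegment ℝ (f s) (f t) = f '' Ioo s t := by
    rw [← openSegment_eq_Ioo (hsc.trans hct)]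
    exact (image_openSegment ℝ (AffineMap.lineMap a b : ℝ →ᵃ[ℝ] V) s t).symm
  refine ⟨f s, ⟨hsC, s, ⟨hs.1, hs.2.trans hc.2⟩, rfl⟩, f t, ⟨htC, t, ⟨hc.1.trans ht.1, ht.2⟩, rfl⟩,
    ?_, ?_⟩
  · rw [hopen]
    exact ⟨c, ⟨hsc, hct⟩, rfl⟩
  · rw [hopen, Set.disjoint_left]
    rintro _ ⟨u, hu, rfl⟩ huC
    rcases le_total u c with huc | huc
    · exact (hsmax ⟨huC, hs.1.trans hu.1.le, huc⟩).not_gt hu.1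
    · exact (htmin ⟨huC, huc, hu.2.le.trans ht.2⟩).not_gt hu.2

namespace SimpleGeodesicTriangle

section

variable {M : Type*} [MetricSpace M] {E : Set M} (T : SimpleGeodesicTriangle E)

theorem im_subset : T.im ⊆ E := by
  rintro _ ((⟨t, -, rfl⟩ | ⟨t, -, rfl⟩) | ⟨t, -, rfl⟩) <;> exact Subtype.coe_prop _

theorem isCompact_im : IsCompact T.im := by
  obtain ⟨φ, hφ, -, h⟩ := T.simple
  change range φ = T.im at h
  exact h ▸ isCompact_range hφ

theorem exists_circle_param : ∃ c : Circle → E, Continuous c ∧ Function.Injective c ∧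
    range (Subtype.val ∘ c) = T.im := by
  obtain ⟨φ, hφ, hφi, h⟩ := T.simple
  change range φ = T.im at h
  let e : ℂ ≃ₗᵢ[ℝ] EuclideanSpace ℝ (Fin 2) := Complex.orthonormalBasisOneI.repr
  let k : Circle → Metric.sphere (0 : EuclideanSpace ℝ (Fin 2)) 1 := fun z =>
    ⟨e z, by simp [Circle.norm_coe]⟩
  have hk : Continuous k := (e.continuous.comp continuous_subtype_val).subtype_mk _
  have hki : Function.Injective k := fun z w hzw =>
    Subtype.ext (e.injective (congrArg Subtype.val hzw))
  have hks : Function.Surjective k := fun x =>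
    ⟨⟨e.symm x, by simp [Submonoid.unitSphere]⟩, Subtype.ext (e.apply_symm_apply _)⟩
  have hmem : ∀ z, φ (k z) ∈ E := fun z => T.im_subset (h ▸ mem_range_self _)
  refine ⟨fun z => ⟨φ (k z), hmem z⟩, (hφ.comp hk).subtype_mk _,
    fun z w hzw => hki (hφi (congrArg Subtype.val hzw)), ?_⟩
  rw [← h, ← hks.range_comp]
  rfl

theorem compl_interior : T.interiorᶜ = T.exterior ∪ T.im := by
  ext w
  change ¬(_ ∧ _) ↔ (_ ∧ _) ∨ _
  by_cases h : w ∈ T.im <;> simp [h]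

theorem disjoint_interior_exterior : Disjoint T.interior T.exterior :=
  Set.disjoint_left.2 fun _ h h' => h'.2 h.2

theorem isOpen_interior [LocallyConnectedSpace M] : IsOpen T.interior := by
  have ho : IsOpen T.imᶜ := T.isCompact_im.isClosed.isOpen_compl
  refine isOpen_iff_mem_nhds.2 fun w hw => ?_
  filter_upwards [(ho.connectedComponentIn (x := w)).mem_nhds (mem_connectedComponentIn hw.1)]
    with z hz
  exact ⟨connectedComponentIn_subset _ _ hz, connectedComponentIn_eq hz ▸ hw.2⟩

theorem isOpen_exterior [LocallyConnectedSpace M] : IsOpen T.exterior := by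
  have ho : IsOpen T.imᶜ := T.isCompact_im.isClosed.isOpen_compl
  refine isOpen_iff_mem_nhds.2 fun w hw => ?_
  filter_upwards [(ho.connectedComponentIn (x := w)).mem_nhds (mem_connectedComponentIn hw.1)]
    with z hz
  exact ⟨connectedComponentIn_subset _ _ hz, connectedComponentIn_eq hz ▸ hw.2⟩

theorem closure_interior_subset [LocallyConnectedSpace M] :
    closure T.interior ⊆ T.interior ∪ T.im := fun w hw => by
  by_contra hcon
  have hwe : w ∈ T.exterior := by
    have h : w ∈ T.interiorᶜ := fun h => hcon (.inl h)
    rw [compl_interior] at h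
    exact h.resolve_right fun h => hcon (.inr h)
  exact (T.disjoint_interior_exterior.closure_left T.isOpen_exterior).le_bot ⟨hw, hwe⟩

/-- Every edge is traced by a geodesic segment between two vertices. -/
theorem IsEdge.exists_isGeodesicSegment {T : SimpleGeodesicTriangle E} {A : Set M}
    (hA : T.IsEdge A) : ∃ (γ : ℝ → E) (D : ℝ) (x y : E), IsGeodesicSegment γ D x y ∧
      (x = T.p ∨ x = T.q ∨ x = T.r) ∧ (y = T.p ∨ y = T.q ∨ y = T.r) ∧
      (Subtype.val ∘ γ) '' Icc 0 D = A := by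
  rcases hA with rfl | rfl | rfl
  · exact ⟨_, _, _, _, T.hσ, by simp, by simp, rfl⟩
  · exact ⟨_, _, _, _, T.hτ, by simp, by simp, rfl⟩
  · exact ⟨_, _, _, _, T.hρ, by simp, by simp, rfl⟩

theorem IsEdge.subset_im {T : SimpleGeodesicTriangle E} {A : Set M} (hA : T.IsEdge A) :
    A ⊆ T.im := by
  rcases hA with rfl | rfl | rfl
  · exact fun _ h => .inl (.inl h)
  · exact fun _ h => .inl (.inr h)
  · exact fun _ h => .inr h

end

variable {E : Set (EuclideanSpace ℝ (Fin 2))} (T : SimpleGeodesicTriangle E)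

theorem interior_subset [SimplyConnectedSpace E] : T.interior ⊆ E := fun w hw => by
  by_contra hwE
  let e : EuclideanSpace ℝ (Fin 2) ≃ₗᵢ[ℝ] ℂ := Complex.orthonormalBasisOneI.repr.symm
  obtain ⟨c, hc, hci, hcr⟩ := T.exists_circle_param
  have hrange : range ((e ∘ Subtype.val : E → ℂ) ∘ c) = e '' T.im := by
    rw [← hcr, ← range_comp]; rfl
  have hlog := HasContinuousLog.of_loop_in_simplyConnected (j := (e ∘ Subtype.val : E → ℂ))
    (w := e w) (e.continuous.comp continuous_subtype_val)
    (fun x hx => hwE (e.injective hx ▸ x.2)) hc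
    ((e.injective.comp Subtype.val_injective).comp hci)
  rw [hrange] at hlog
  refine not_hasContinuousLog_of_isBounded
    (T.isCompact_im.image e.continuous).isClosed ?_ ?_ hlog
  · rw [e.injective.mem_set_image]
    exact hw.1
  · exact (isBounded_connectedComponentIn_image e hw.1).2 hw.2

/-- A point of an edge around which the triangle coincides with this edge is a limit of points
of the Jordan interior. -/
theorem mem_closure_interior {γ : ℝ → E} {D : ℝ} {x y : E} (h : IsGeodesicSegment γ D x y)
    (hsub : (Subtype.val ∘ γ) '' Icc 0 D ⊆ T.im) {t : ℝ} (ht : t ∈ Ioo 0 D) {r : ℝ} (hr : 0 < r)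
    (hloc : T.im ∩ Metric.ball (γ t : EuclideanSpace ℝ (Fin 2)) r ⊆
      (Subtype.val ∘ γ) '' Icc 0 D) :
    (γ t : EuclideanSpace ℝ (Fin 2)) ∈ closure T.interior := by
  refine Metric.mem_closure_iff.2 fun ε hε => ?_
  let e : EuclideanSpace ℝ (Fin 2) ≃ₗᵢ[ℝ] ℂ := Complex.orthonormalBasisOneI.repr.symm
  set g : ℝ → ℂ := e ∘ Subtype.val ∘ γ with hg
  have hinj : InjOn g (Icc 0 D) :=
    ((e.injective.comp Subtype.val_injective).injOn (s := univ)).comp h.injOn (mapsTo_univ _ _)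
  have hlip : LipschitzOnWith 1 g (Icc 0 D) := LipschitzOnWith.of_dist_le_mul fun s hs u hu => by
    simpa [hg, Subtype.dist_eq] using h.lipschitzOnWith.dist_le_mul s hs u hu
  set δ := min (ε / 2) (r / 2) with hδ
  have hδ0 : 0 < δ := by positivity
  have hlt : t < min D (t + δ) := lt_min ht.2 (by linarith)
  have hIcc : Icc t (min D (t + δ)) ⊆ Icc 0 D := Icc_subset_Icc ht.1.le (min_le_left _ _)
  obtain ⟨t₀, ht₀, v, hv, hd⟩ :=
    exists_hasDerivAt_ne_zero hlt (hlip.mono hIcc) (hinj.mono hIcc)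
  have ht₀D : t₀ ∈ Ioo 0 D := ⟨ht.1.trans ht₀.1, ht₀.2.trans_le (min_le_left _ _)⟩
  have hdist : dist (g t₀) (g t) < δ := by
    refine (hlip.dist_le_mul t₀ (Ioo_subset_Icc_self ht₀D) t (Ioo_subset_Icc_self ht)).trans_lt ?_
    have := ht₀.2.trans_le (min_le_right _ _)
    rw [Real.dist_eq, abs_of_pos (sub_pos.2 ht₀.1)]
    simp only [NNReal.coe_one, one_mul]
    linarith
  obtain ⟨c, hc, hci, hcr⟩ := T.exists_circle_param
  have hrange : range (e ∘ Subtype.val ∘ c) = e '' T.im := by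
    rw [← hcr, ← range_comp]
  obtain ⟨w, hwK, hwd, hwl⟩ := exists_not_hasContinuousLog_near (ψ := e ∘ Subtype.val ∘ c)
    (e.continuous.comp (continuous_subtype_val.comp hc))
    (e.injective.comp (Subtype.val_injective.comp hci)) hlip.continuousOn hinj
    (fun u hu => hrange ▸ mem_image_of_mem e (hsub (mem_image_of_mem _ hu)))
    ht₀D hv hd (half_pos hr) (by
      rw [hrange]
      rintro _ ⟨⟨z, hz, rfl⟩, hzb⟩
      have hzr : dist (e z) (g t) < r := by
        have := min_le_right (ε / 2) (r / 2)
        linarith [dist_triangle (e z) (g t₀) (g t), Metric.mem_ball.1 hzb]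
      obtain ⟨u, hu, rfl⟩ := hloc ⟨hz, by simpa [hg] using hzr⟩
      exact ⟨u, hu, rfl⟩) (half_pos hε)
  rw [hrange] at hwK hwl
  obtain ⟨w, rfl⟩ := e.surjective w
  have hw : w ∉ T.im := fun h => hwK (mem_image_of_mem e h)
  refine ⟨w, ⟨hw, ?_⟩, ?_⟩
  · by_contra hb
    rw [← isBounded_connectedComponentIn_image e hw] at hb
    exact hwl (.of_not_isBounded (T.isCompact_im.image e.continuous) hb)
  · rw [← e.isometry.dist_eq, dist_comm]
    change dist (e w) (g t) < ε
    have := min_le_left (ε / 2) (r / 2)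
    linarith [dist_triangle (e w) (g t₀) (g t)]

/-- In a ball in which the triangle coincides with one of its edges, the complement of the
Jordan interior is convex. -/
theorem convex_compl_interior_inter_ball [SimplyConnectedSpace E] {γ : ℝ → E} {D : ℝ} {x y : E}
    (h : IsGeodesicSegment γ D x y) (hsub : (Subtype.val ∘ γ) '' Icc 0 D ⊆ T.im)
    {p : EuclideanSpace ℝ (Fin 2)} {r : ℝ}
    (hloc : T.im ∩ Metric.ball p r ⊆ (Subtype.val ∘ γ) '' Icc 0 D) :
    Convex ℝ (T.interiorᶜ ∩ Metric.ball p r) := by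
  refine convex_iff_segment_subset.2 fun a ha b hb z hz => ?_
  refine ⟨fun hzS => ?_, (convex_ball p r).segment_subset ha.2 hb.2 hz⟩
  obtain ⟨a', ⟨ha'C, ha's⟩, b', ⟨hb'C, hb's⟩, hz', hdisj⟩ := exists_maximal_segment_compl
    T.isOpen_interior.isClosed_compl ha.1 hb.1 hz (not_not.2 hzS)
  have hopen : openSegment ℝ a' b' ⊆ T.interior := disjoint_compl_right_iff_subset.1 hdisj
  have hseg : segment ℝ a' b' ⊆ T.interior ∪ T.im :=
    by
    rw [← closure_openSegment]
    exact (closure_mono hopen).trans T.closure_interior_subset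
  have hsegE : segment ℝ a' b' ⊆ E := hseg.trans (union_subset T.interior_subset T.im_subset)
  have hball := (convex_ball p r).segment_subset ha.2 hb.2
  obtain ⟨s, hs, rfl⟩ :=
    hloc ⟨(hseg (left_mem_segment ℝ a' b')).resolve_left ha'C, hball ha's⟩
  obtain ⟨t, ht, rfl⟩ :=
    hloc ⟨(hseg (right_mem_segment ℝ _ b')).resolve_left hb'C, hball hb's⟩
  have key : ∃ u ∈ Icc 0 D, (γ u : EuclideanSpace ℝ (Fin 2)) ∈
      openSegment ℝ (γ s : EuclideanSpace ℝ (Fin 2)) (γ t) := by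
    rcases lt_trichotomy s t with hst | rfl | hst
    · exact h.exists_mem_openSegment hs ht hst hsegE
    · rw [openSegment_same, mem_singleton_iff] at hz'
      exact absurd hzS (hz' ▸ ha'C)
    · rw [openSegment_symm]
      exact h.exists_mem_openSegment ht hs hst
        (by rw [segment_symm]; exact hsegE)
  obtain ⟨u, hu, hus⟩ := key
  exact (hopen hus).1 (hsub (mem_image_of_mem _ hu))

/-- Near a non-vertex point `p` of an edge, the complement of the Jordan interior lies in a
closed half-plane with `p` on its boundary, and the Jordan exterior lies in the open half-plane. -/
theorem exists_supporting_functional [SimplyConnectedSpace E] {A : Set (EuclideanSpace ℝ (Fin 2))}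
    (hA : T.IsEdge A) {p : EuclideanSpace ℝ (Fin 2)} (hp : p ∈ A)
    (hnotvertex : p ≠ (T.p : EuclideanSpace ℝ (Fin 2)) ∧
      p ≠ (T.q : EuclideanSpace ℝ (Fin 2)) ∧ p ≠ (T.r : EuclideanSpace ℝ (Fin 2)))
    {r : ℝ} (hr : 0 < r) (hball : T.im ∩ Metric.ball p r ⊆ A)
    (hne : (T.exterior ∩ Metric.ball p r).Nonempty) :
    ∃ f : StrongDual ℝ (EuclideanSpace ℝ (Fin 2)),
      (∀ z ∈ T.exterior ∩ Metric.ball p r, f z < f p) ∧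
      ∀ z ∈ T.im ∩ Metric.ball p r, f z ≤ f p := by
  obtain ⟨γ, D, x, y, h, hx, hy, rfl⟩ := hA.exists_isGeodesicSegment
  have hconv := T.convex_compl_interior_inter_ball h hA.subset_im hball
  set C := T.interiorᶜ ∩ Metric.ball p r with hCdef
  have hUC : T.exterior ∩ Metric.ball p r ⊆ _root_.interior C :=
    interior_maximal (inter_subset_inter_left _ (T.compl_interior ▸ subset_union_left))
      (T.isOpen_exterior.inter Metric.isOpen_ball)
  have hpS : p ∈ closure T.interior := by
    obtain ⟨t, ht, rfl⟩ := hp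
    refine T.mem_closure_interior h hA.subset_im ⟨ht.1.lt_of_ne ?_, ht.2.lt_of_ne ?_⟩ hr hball
    · rintro rfl
      rw [Function.comp_apply, h.1] at hnotvertex
      rcases hx with rfl | rfl | rfl <;> simp at hnotvertex
    · rintro rfl
      rw [Function.comp_apply, h.2.1] at hnotvertex
      rcases hy with rfl | rfl | rfl <;> simp at hnotvertex
  have hpC : p ∉ _root_.interior C := fun hpC => by
    obtain ⟨w, hwC, hwS⟩ := mem_closure_iff.1 hpS _ _root_.isOpen_interior hpC
    exact (_root_.interior_subset hwC).1 hwS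
  obtain ⟨f, hf⟩ := geometric_hahn_banach_open_point hconv.interior _root_.isOpen_interior hpC
  refine ⟨f, fun z hz => hf z (hUC hz), fun z hz => ?_⟩
  have hzC : z ∈ closure (_root_.interior C) := by
    rw [hconv.closure_interior_eq_closure_of_nonempty_interior (hne.mono hUC)]
    exact subset_closure ⟨fun hzS => hzS.1 hz.1, hz.2⟩
  exact closure_minimal (fun z hz => (hf z hz).le) (isClosed_le f.continuous continuous_const) hzC

end SimpleGeodesicTriangle

/-- Let `L` be a straight line through a non-vertex point `p` of an edge
`A` of a simple geodesic triangle `T`, and `r > 0` with `T ∩ B(p,r) ⊆ A`.  Writing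
`L⁻`, `L⁺` for the two components of `(L ∩ B(p,r)) \ {p}`, at least one of them is
disjoint from the Jordan exterior `U`, and if `L⁻` meets `T` then `L⁺` is disjoint
from `U`. -/
theorem line_locally_interior (E : Set (EuclideanSpace ℝ (Fin 2)))
    (hclosed : IsClosed E) (hsc : SimplyConnectedSpace E)
    (hrect : ∀ x y : E, pathEDist x y ≠ ⊤)
    (T : SimpleGeodesicTriangle E) (A : Set (EuclideanSpace ℝ (Fin 2)))
    (hA : T.IsEdge A) (p : EuclideanSpace ℝ (Fin 2)) (hp : p ∈ A)
    (hnotvertex : p ≠ (T.p : EuclideanSpace ℝ (Fin 2)) ∧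
      p ≠ (T.q : EuclideanSpace ℝ (Fin 2)) ∧ p ≠ (T.r : EuclideanSpace ℝ (Fin 2)))
    (v : EuclideanSpace ℝ (Fin 2)) (hv : ‖v‖ = 1)
    (r : ℝ) (hr : 0 < r) (hball : T.im ∩ Metric.ball p r ⊆ A) :
    ((fun t : ℝ => p + t • v) '' Set.Ioo (-r) 0 ∩ T.exterior = ∅ ∨
        (fun t : ℝ => p + t • v) '' Set.Ioo 0 r ∩ T.exterior = ∅) ∧
      ((fun t : ℝ => p + t • v) '' Set.Ioo (-r) 0 ∩ T.im ≠ ∅ →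
        (fun t : ℝ => p + t • v) '' Set.Ioo 0 r ∩ T.exterior = ∅) := by

  have hmem : ∀ t : ℝ, |t| < r → p + t • v ∈ Metric.ball p r := fun t ht => by
    simpa [Metric.mem_ball, dist_eq_norm, norm_smul, hv] using ht
  have key : ((fun t : ℝ => p + t • v) '' Ioo (-r) 0 ∩ (T.exterior ∪ T.im)).Nonempty →
      (fun t : ℝ => p + t • v) '' Ioo 0 r ∩ T.exterior = ∅ := by
    rintro ⟨_, ⟨s, hs, rfl⟩, hsT⟩
    by_contra! hcon
    obtain ⟨_, ⟨t, ht, rfl⟩, htU⟩ := hcon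
    have hsb := hmem s (abs_lt.2 ⟨hs.1, hs.2.trans hr⟩)
    have htb := hmem t (abs_lt.2 ⟨by linarith [ht.1], ht.2⟩)
    obtain ⟨f, hfU, hfT⟩ := T.exists_supporting_functional hA hp hnotvertex hr hball ⟨_, htU, htb⟩
    have h1 : f (p + t • v) < f p := hfU _ ⟨htU, htb⟩
    have h2 : f (p + s • v) ≤ f p :=
      hsT.elim (fun h => (hfU _ ⟨h, hsb⟩).le) fun h => hfT _ ⟨h, hsb⟩
    simp only [map_add, map_smul, smul_eq_mul] at h1 h2
    nlinarith [ht.1, hs.2]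
  refine ⟨or_iff_not_imp_left.2 fun h => key ?_, fun h => key ?_⟩
  · exact (nonempty_iff_ne_empty.2 h).mono (inter_subset_inter_right _ subset_union_left)
  · exact (nonempty_iff_ne_empty.2 h).mono (inter_subset_inter_right _ subset_union_right)
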